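/- For every L > 0 there exist constants c_L > 0 and C_L > 0 such that for all real a > 0 and all T, λ > 0 with Tλ ≤ L, one has (c_L / (1 + log⁺(1/(Tλ)))) · (log⁺(2T/a²) + e^{−a²/T}/(1 + a²/(2T))) ≤ H̄_T^λ(a) ≤ (C_L / (1 + log⁺(1/(Tλ)))) · (log⁺(2T/a²) + e^{−a²/(2T)}/(1 + a²/(2T))). -/

import Mathlib

open MeasureTheory Real

/-- The Volterra function `ν(x) = ∫₀^∞ x^s / Γ(s+1) ds` (for `x > 0`; `ν(0) = 0`). -/
noncomputable def volterra (x : ℝ) : ℝ := ∫ s in Set.Ioi (0 : ℝ), x ^ s / Real.Gamma (s + 1)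

/-- `H̄_T^λ(a) = ∫₀^T (e^{−a²/(2r)} / r) ν((T−r)λ) dr`. -/
noncomputable def Hbar (T lam a : ℝ) : ℝ :=
  ∫ r in (0 : ℝ)..T, Real.exp (-(a ^ 2 / (2 * r))) / r * volterra ((T - r) * lam)

/-- `log⁺ u = max (log u) 0`. -/
noncomputable def logPlus (u : ℝ) : ℝ := max (Real.log u) 0

lemma rpow_le_exp_mul_Gamma {B s : ℝ} (hB : 0 < B) (hs : 0 ≤ s) :
    B ^ s ≤ exp (B + 1) * Gamma (s + 1) := by
  have hint := GammaIntegral_convergent (show 0 < s + 1 by linarith)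
  have hsub : Set.Ioc B (B + 1) ⊆ Set.Ioi 0 := fun t ht => hB.trans ht.1
  have h1 : exp (-(B + 1)) * B ^ s ≤
      ∫ t in Set.Ioc B (B + 1), exp (-t) * t ^ (s + 1 - 1) := by
    have h := setIntegral_ge_of_const_le_real (μ := volume) (s := Set.Ioc B (B + 1))
      (f := fun t => exp (-t) * t ^ (s + 1 - 1))
      (c := exp (-(B + 1)) * B ^ s) measurableSet_Ioc (by simp) ?_ (hint.mono_set hsub)
    · simpa using h
    · intro t ht
      have := ht.1
      have := ht.2
      rw [add_sub_cancel_right]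
      gcongr
  have h2 : exp (-(B + 1)) * B ^ s ≤ Gamma (s + 1) := by
    rw [Gamma_eq_integral (by linarith)]
    refine h1.trans (setIntegral_mono_set hint ?_ hsub.eventuallyLE)
    filter_upwards [ae_restrict_mem measurableSet_Ioi] with t ht
    exact mul_nonneg (exp_pos _).le (rpow_nonneg (le_of_lt ht) _)
  calc B ^ s = exp (B + 1) * (exp (-(B + 1)) * B ^ s) := by
        rw [← mul_assoc, ← exp_add]; simp
    _ ≤ _ := by gcongr

lemma Gamma_add_one_le_one {s : ℝ} (h0 : 0 ≤ s) (h1 : s ≤ 1) : Gamma (s + 1) ≤ 1 := by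
  have h := convexOn_Gamma.le_max_of_mem_Icc (x := 1) (y := 2) (z := s + 1)
    (by simp) (by simp) ⟨by linarith, by linarith⟩
  simpa [Gamma_two] using h

lemma logPlus_nonneg (u : ℝ) : 0 ≤ logPlus u := le_max_right _ _

lemma mul_exp_logPlus_inv_le {M x : ℝ} (hM : 1 ≤ M) (hx : 0 < x) (hxM : x ≤ M) :
    x * exp (logPlus (1 / x)) ≤ M := by
  unfold logPlus
  rcases le_total (log (1 / x)) 0 with h | h
  · rw [max_eq_right h, exp_zero, mul_one]
    exact hxM
  · rw [max_eq_left h, exp_log (by positivity), mul_one_div_cancel hx.ne']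
    exact hM

lemma volterra_integrand_le {M x s : ℝ} (hM : 1 ≤ M) (hx : 0 < x) (hxM : x ≤ M) (hs : 0 ≤ s) :
    x ^ s / Gamma (s + 1) ≤
      exp (exp 1 * M + 1) * exp (-(1 + logPlus (1 / x)) * s) := by
  have hG : 0 < Gamma (s + 1) := Gamma_pos_of_pos (by linarith)
  have hB : 0 < exp 1 * M := by positivity
  have h1 := mul_exp_logPlus_inv_le hM hx hxM
  have h2 : (x * exp (1 + logPlus (1 / x))) ^ s ≤ (exp 1 * M) ^ s := by
    refine rpow_le_rpow (by positivity) ?_ hs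
    rw [exp_add]
    nlinarith [exp_pos 1]
  rw [mul_rpow hx.le (exp_pos _).le, ← exp_mul] at h2
  have h3 := h2.trans (rpow_le_exp_mul_Gamma hB hs)
  rw [div_le_iff₀ hG, neg_mul, exp_neg, mul_right_comm, ← div_eq_mul_inv,
    le_div_iff₀ (exp_pos _)]
  exact h3

lemma volterra_integrand_nonneg {x s : ℝ} (hx : 0 ≤ x) (hs : 0 ≤ s) :
    0 ≤ x ^ s / Gamma (s + 1) :=
  div_nonneg (rpow_nonneg hx _) (Gamma_pos_of_pos (by linarith)).le

lemma integrableOn_volterra_integrand {x : ℝ} (hx : 0 < x) :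
    IntegrableOn (fun s => x ^ s / Gamma (s + 1)) (Set.Ioi 0) := by
  have hneg : -(1 + logPlus (1 / x)) < 0 := by linarith [logPlus_nonneg (1 / x)]
  refine Integrable.mono' ((integrableOn_exp_mul_Ioi hneg 0).const_mul
    (exp (exp 1 * max x 1 + 1))) ?_ ?_
  · refine ContinuousOn.aestronglyMeasurable (fun s hs => ?_) measurableSet_Ioi
    have hs : 0 < s := hs
    have hG : DifferentiableAt ℝ Gamma (s + 1) :=
      differentiableAt_Gamma fun m => by
        have : (0 : ℝ) ≤ m := m.cast_nonneg
        intro h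
        linarith
    have hG' : ContinuousAt (fun s => Gamma (s + 1)) s :=
      ContinuousAt.comp (f := fun s : ℝ => s + 1) hG.continuousAt (by fun_prop)
    exact ((continuousAt_const_rpow hx.ne').div hG'
      (Gamma_pos_of_pos (by linarith)).ne').continuousWithinAt
  · filter_upwards [ae_restrict_mem measurableSet_Ioi] with s hs
    have hs : 0 ≤ s := le_of_lt hs
    rw [norm_of_nonneg (volterra_integrand_nonneg hx.le hs)]
    exact volterra_integrand_le (le_max_right _ _) hx (le_max_left _ _) hs

lemma volterra_zero : volterra 0 = 0 := by
  unfold volterra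
  rw [setIntegral_congr_fun (g := fun _ => (0 : ℝ)) measurableSet_Ioi]
  · simp
  · intro s hs
    have hs : 0 < s := hs
    simp [zero_rpow hs.ne']

lemma volterra_nonneg {x : ℝ} (hx : 0 ≤ x) : 0 ≤ volterra x :=
  setIntegral_nonneg measurableSet_Ioi fun _ hs => volterra_integrand_nonneg hx (le_of_lt hs)

lemma volterra_monotoneOn : MonotoneOn volterra (Set.Ici 0) := by
  intro x hx y hy hxy
  rcases (show 0 ≤ x from hx).eq_or_lt with rfl | hx
  · rw [volterra_zero]
    exact volterra_nonneg hy
  · refine setIntegral_mono_on (integrableOn_volterra_integrand hx)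
      (integrableOn_volterra_integrand (hx.trans_le hxy)) measurableSet_Ioi fun s hs => ?_
    have hs : 0 < s := hs
    have hG : 0 < Gamma (s + 1) := Gamma_pos_of_pos (by linarith)
    gcongr

lemma volterra_le {M x : ℝ} (hM : 1 ≤ M) (hx : 0 < x) (hxM : x ≤ M) :
    volterra x ≤ exp (exp 1 * M + 1) / (1 + logPlus (1 / x)) := by
  have hneg : -(1 + logPlus (1 / x)) < 0 := by linarith [logPlus_nonneg (1 / x)]
  calc volterra x
      ≤ ∫ s in Set.Ioi 0, exp (exp 1 * M + 1) * exp (-(1 + logPlus (1 / x)) * s) :=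
        setIntegral_mono_on (integrableOn_volterra_integrand hx)
          ((integrableOn_exp_mul_Ioi hneg 0).const_mul _) measurableSet_Ioi fun s hs =>
            volterra_integrand_le hM hx hxM (le_of_lt hs)
    _ = _ := by
      rw [integral_const_mul, integral_exp_mul_Ioi hneg, mul_zero, exp_zero, neg_div_neg_eq,
        mul_one_div]

lemma le_volterra_half {x : ℝ} (hx : 0 < x) :
    exp (-1) / (1 + logPlus (1 / x)) ≤ volterra (x / 2) := by
  set l := logPlus (1 / x) with hl
  have hl0 : 0 ≤ l := logPlus_nonneg _
  have hxl : exp (-l) ≤ x := by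
    have h : log (1 / x) ≤ l := le_max_left _ _
    rw [one_div, log_inv] at h
    calc exp (-l) ≤ exp (log x) := exp_le_exp.2 (by linarith)
      _ = x := exp_log hx
  have hy : exp (-(1 + l)) ≤ x / 2 := by
    have h2 : exp (-1) ≤ 1 / 2 := by
      rw [exp_neg, inv_eq_one_div]
      exact one_div_le_one_div_of_le two_pos (by linarith [add_one_le_exp (1 : ℝ)])
    calc exp (-(1 + l)) = exp (-1) * exp (-l) := by rw [← exp_add]; ring_nf
      _ ≤ 1 / 2 * x := by gcongr
      _ = x / 2 := by ring
  have hint := integrableOn_volterra_integrand (half_pos hx)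
  have hsub : Set.Ioc 0 (1 / (1 + l)) ⊆ Set.Ioi 0 := fun t ht => ht.1
  have h1 := setIntegral_ge_of_const_le_real (μ := volume) (s := Set.Ioc 0 (1 / (1 + l)))
      (c := exp (-1)) measurableSet_Ioc (by simp) (fun s hs => ?_) (hint.mono_set hsub)
  · refine le_trans (le_of_eq ?_) (h1.trans (setIntegral_mono_set hint ?_ hsub.eventuallyLE))
    · rw [volume_real_Ioc_of_le (by positivity)]
      ring
    · filter_upwards [ae_restrict_mem measurableSet_Ioi] with t ht
      exact volterra_integrand_nonneg (half_pos hx).le (le_of_lt ht)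
  · have hs0 : 0 < s := hs.1
    have hs1 : s * (1 + l) ≤ 1 := (le_div_iff₀ (by linarith)).1 hs.2
    have hG : 0 < Gamma (s + 1) := Gamma_pos_of_pos (by linarith)
    have hG1 : Gamma (s + 1) ≤ 1 := Gamma_add_one_le_one hs0.le (by nlinarith)
    calc exp (-1) ≤ exp (-(1 + l) * s) := exp_le_exp.2 (by linarith)
      _ = exp (-(1 + l)) ^ s := by rw [exp_mul]
      _ ≤ (x / 2) ^ s := rpow_le_rpow (exp_pos _).le hy hs0.le
      _ ≤ _ := le_div_self (rpow_nonneg (half_pos hx).le _) hG hG1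

lemma exp_neg_div_le {p r : ℝ} (hp : 0 < p) (hr : 0 < r) :
    exp (-(p / r)) ≤ r / (r + p) := by
  have h : (r + p) / r ≤ exp (p / r) := by
    rw [add_div, div_self hr.ne']
    linarith [add_one_le_exp (p / r)]
  rw [exp_neg, ← inv_div (r + p) r]
  exact inv_anti₀ (by positivity) h

lemma exp_neg_div_div_le {p r : ℝ} (hp : 0 < p) (hr : 0 < r) :
    exp (-(p / r)) / r ≤ 1 / (r + p) := by
  rw [div_le_iff₀ hr]
  exact (exp_neg_div_le hp hr).trans_eq (by ring)

lemma integrableOn_exp_neg_div_div {p : ℝ} (hp : 0 < p) (T : ℝ) :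
    IntegrableOn (fun r => exp (-(p / r)) / r) (Set.Icc 0 T) := by
  rw [integrableOn_Icc_iff_integrableOn_Ioc]
  refine Measure.integrableOn_of_bounded (M := 1 / p) (by simp) ?_ ?_
  · exact Measurable.aestronglyMeasurable (by fun_prop)
  · filter_upwards [ae_restrict_mem measurableSet_Ioc] with r hr
    have hr : 0 < r := hr.1
    rw [norm_of_nonneg (by positivity)]
    exact (exp_neg_div_div_le hp hr).trans (one_div_le_one_div_of_le hp (by linarith))

lemma hasDerivAt_exp_neg_div {p r : ℝ} (hr : r ≠ 0) :
    HasDerivAt (fun r => exp (-(p / r))) (exp (-(p / r)) * (p / r ^ 2)) r := by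
  have h := ((hasDerivAt_inv hr).const_mul p).fun_neg.exp
  simp only [mul_neg, neg_neg, ← div_eq_mul_inv] at h
  exact h

lemma continuousOn_exp_neg_div_mul {p T : ℝ} (hp : 0 < p) {f : ℝ → ℝ}
    (hf : ContinuousOn f (Set.Icc 0 T)) (hf0 : f 0 = 0) :
    ContinuousOn (fun r => exp (-(p / r)) * f r) (Set.Icc 0 T) := by
  intro r hr
  rcases hr.1.eq_or_lt with rfl | h
  · have hf' := (hf 0 hr).norm
    unfold ContinuousWithinAt at hf' ⊢
    simp only [hf0, norm_zero, mul_zero] at hf' ⊢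
    refine squeeze_zero_norm' ?_ hf'
    filter_upwards [self_mem_nhdsWithin] with t ht
    rw [norm_mul, norm_of_nonneg (exp_pos _).le]
    refine mul_le_of_le_one_left (norm_nonneg _) (exp_le_one_iff.2 ?_)
    have := ht.1
    rw [neg_nonpos]
    positivity
  · exact (hasDerivAt_exp_neg_div h.ne').continuousAt.continuousWithinAt.mul (hf r hr)

lemma integral_exp_neg_div_div_le_log {p T : ℝ} (hp : 0 < p) (hT : 0 < T) :
    ∫ r in (0 : ℝ)..T, exp (-(p / r)) / r ≤ log (T + p) - log p := by
  have h := intervalIntegral.integral_le_sub_of_hasDeriv_right_of_le hT.le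
    (g := fun r => log (r + p)) (g' := fun r => 1 / (r + p))
    (φ := fun r => exp (-(p / r)) / r) ?_ ?_ (integrableOn_exp_neg_div_div hp T) ?_
  · simpa using h
  · exact ContinuousOn.log (by fun_prop) fun r hr => by linarith [hr.1]
  · intro r hr
    exact (((hasDerivAt_id r).add_const p).log (by simp; linarith [hr.1])).hasDerivWithinAt
  · intro r hr
    exact exp_neg_div_div_le hp hr.1

lemma integral_exp_neg_div_div_le_exp {p T : ℝ} (hT : 0 < T) (hpT : T ≤ p) :
    ∫ r in (0 : ℝ)..T, exp (-(p / r)) / r ≤ 2 / (1 + p / T) * exp (-(p / T)) := by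
  have hp : 0 < p := hT.trans_le hpT
  have h := intervalIntegral.integral_le_sub_of_hasDeriv_right_of_le hT.le
    (g := fun r => 2 / (T + p) * (exp (-(p / r)) * r))
    (g' := fun r => 2 / (T + p) * (exp (-(p / r)) * (p / r ^ 2) * r + exp (-(p / r)) * 1))
    (φ := fun r => exp (-(p / r)) / r) ?_ ?_ (integrableOn_exp_neg_div_div hp T) ?_
  · refine h.trans_eq ?_
    simp only [mul_zero, sub_zero]
    field_simp
  · exact (continuousOn_exp_neg_div_mul hp continuousOn_id rfl).const_mul _
  · intro r hr
    exact (((hasDerivAt_exp_neg_div hr.1.ne').mul (hasDerivAt_id r)).const_mul _).hasDerivWithinAt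
  · intro r hr
    have hr0 := hr.1
    have : 2 / (T + p) * (exp (-(p / r)) * (p / r ^ 2) * r + exp (-(p / r)) * 1) =
        exp (-(p / r)) / r * (2 * (r + p) / (T + p)) := by
      field_simp
      ring
    rw [this]
    refine le_mul_of_one_le_right (by positivity) ?_
    rw [one_le_div (by positivity)]
    linarith

lemma le_integral_exp_neg_div_div {p S : ℝ} (hp : 0 < p) (hS : 0 < S) :
    1 / 2 * (exp (-(p / S)) * (log (S + p) - log p)) ≤
      ∫ r in (0 : ℝ)..S, exp (-(p / r)) / r := by
  have h := intervalIntegral.sub_le_integral_of_hasDeriv_right_of_le hS.le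
    (g := fun r => 1 / 2 * (exp (-(p / r)) * (log (r + p) - log p)))
    (g' := fun r => 1 / 2 * (exp (-(p / r)) * (p / r ^ 2) * (log (r + p) - log p) +
      exp (-(p / r)) * (1 / (r + p))))
    (φ := fun r => exp (-(p / r)) / r) ?_ ?_ (integrableOn_exp_neg_div_div hp S) ?_
  · simpa using h
  · refine (continuousOn_exp_neg_div_mul hp ?_ (by simp)).const_mul _
    refine ContinuousOn.sub (ContinuousOn.log (by fun_prop) fun r hr => ?_) continuousOn_const
    linarith [hr.1]
  · intro r hr
    have hl : HasDerivAt (fun r => log (r + p) - log p) (1 / (r + p)) r :=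
      (((hasDerivAt_id r).add_const p).log (by simp; linarith [hr.1])).sub_const _
    exact (((hasDerivAt_exp_neg_div hr.1.ne').mul hl).const_mul _).hasDerivWithinAt
  · intro r hr
    have hr0 := hr.1
    have h1 : log (r + p) - log p ≤ r / p := by
      rw [← log_div (by positivity) hp.ne']
      refine (log_le_sub_one_of_pos (by positivity)).trans_eq ?_
      field_simp
      ring
    have h2 : p / r ^ 2 * (log (r + p) - log p) ≤ 1 / r := by
      calc p / r ^ 2 * (log (r + p) - log p) ≤ p / r ^ 2 * (r / p) := by gcongr
        _ = 1 / r := by field_simp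
    have h3 : 1 / (r + p) ≤ 1 / r := one_div_le_one_div_of_le hr0 (by linarith)
    calc _ = exp (-(p / r)) * (1 / 2 * (p / r ^ 2 * (log (r + p) - log p) + 1 / (r + p))) := by
          ring
      _ ≤ exp (-(p / r)) * (1 / r) := by gcongr; linarith
      _ = _ := by ring

lemma integral_exp_neg_div_div_le {p T : ℝ} (hp : 0 < p) (hT : 0 < T) :
    ∫ r in (0 : ℝ)..T, exp (-(p / r)) / r ≤
      8 * (logPlus (T / p) + exp (-(p / T)) / (1 + p / T)) := by
  have hl := logPlus_nonneg (T / p)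
  rcases le_total T p with h | h
  · refine (integral_exp_neg_div_div_le_exp hT h).trans ?_
    have : 0 ≤ exp (-(p / T)) / (1 + p / T) := by positivity
    calc _ = 2 * (exp (-(p / T)) / (1 + p / T)) := by ring
      _ ≤ _ := by linarith
  · have h1 : log (T + p) ≤ log 2 + log T := by
      rw [← log_mul two_ne_zero hT.ne']
      exact log_le_log (by positivity) (by linarith)
    have h2 : log T - log p ≤ logPlus (T / p) := by
      rw [← log_div hT.ne' hp.ne']
      exact le_max_left _ _
    have hq : p / T ≤ 1 := (div_le_one hT).2 h
    have h3 : 1 / 6 ≤ exp (-(p / T)) / (1 + p / T) := by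
      calc (1 : ℝ) / 6 = 1 / 3 / 2 := by norm_num
        _ ≤ exp (-1) / 2 := by
          gcongr
          rw [exp_neg, inv_eq_one_div]
          exact one_div_le_one_div_of_le (exp_pos _) (by linarith [exp_one_lt_d9])
        _ ≤ exp (-(p / T)) / (1 + p / T) := by
          gcongr
          linarith
    have := integral_exp_neg_div_div_le_log hp hT
    linarith [log_two_lt_d9]

lemma le_integral_exp_neg_div_div_half {p T : ℝ} (hp : 0 < p) (hT : 0 < T) :
    exp (-2) / 8 * (logPlus (T / p) + exp (-(2 * p / T)) / (1 + p / T)) ≤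
      ∫ r in (0 : ℝ)..T / 2, exp (-(p / r)) / r := by
  refine le_trans ?_ (le_integral_exp_neg_div_div hp (half_pos hT))
  have he : p / (T / 2) = 2 * p / T := by field_simp
  rw [he, ← log_div (by positivity) hp.ne']
  set q := p / T with hq
  have hq0 : 0 < q := by positivity
  have h2q : 2 * p / T = 2 * q := by rw [hq]; ring
  have hTp : T / p = 1 / q := by rw [hq]; field_simp
  have hD : (T / 2 + p) / p = 1 + 1 / (2 * q) := by rw [hq]; field_simp; ring
  rw [h2q, hTp, hD]
  have hE : exp (-2) ≤ 1 := exp_le_one_iff.2 (by norm_num)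
  have hE0 := exp_pos (-2)
  have hD1 : 1 / (2 * (1 + q)) ≤ log (1 + 1 / (2 * q)) := by
    have h := one_sub_inv_le_log_of_pos (show 0 < 1 + 1 / (2 * q) by positivity)
    refine le_trans ?_ h
    rw [show 1 - (1 + 1 / (2 * q))⁻¹ = 1 / (1 + 2 * q) by field_simp; ring]
    exact one_div_le_one_div_of_le (by positivity) (by linarith)
  have hD0 : 0 ≤ log (1 + 1 / (2 * q)) := le_trans (by positivity) hD1
  have hA : exp (-2) / 8 * logPlus (1 / q) ≤
      1 / 4 * (exp (-(2 * q)) * log (1 + 1 / (2 * q))) := by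
    unfold logPlus
    rcases le_total (log (1 / q)) 0 with h | h
    · rw [max_eq_right h, mul_zero]
      positivity
    · rw [max_eq_left h]
      have hq1 : q ≤ 1 := by
        by_contra! hcon
        have := log_neg (by positivity) ((div_lt_one hq0).2 hcon)
        linarith
      have h1 : log (1 / q) ≤ 2 * log (1 + 1 / (2 * q)) := by
        rw [← log_rpow (by positivity)]
        refine log_le_log (by positivity) ?_
        rw [rpow_two, show 1 / q = 2 * (1 / (2 * q)) by field_simp]
        nlinarith [sq_nonneg (1 / (2 * q))]
      calc exp (-2) / 8 * log (1 / q) ≤ exp (-2) / 8 * (2 * log (1 + 1 / (2 * q))) := by gcongr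
        _ = 1 / 4 * (exp (-2) * log (1 + 1 / (2 * q))) := by ring
        _ ≤ _ := by gcongr; linarith
  have hB : exp (-2) / 8 * (exp (-(2 * q)) / (1 + q)) ≤
      1 / 4 * (exp (-(2 * q)) * log (1 + 1 / (2 * q))) := by
    calc exp (-2) / 8 * (exp (-(2 * q)) / (1 + q)) ≤ 1 / 8 * (exp (-(2 * q)) / (1 + q)) := by
          gcongr
      _ = 1 / 4 * (exp (-(2 * q)) * (1 / (2 * (1 + q)))) := by field_simp; norm_num
      _ ≤ _ := by gcongr
  linarith

lemma intervalIntegrable_Hbar_integrand {p T lam : ℝ} (hp : 0 < p) (hT : 0 < T) (hlam : 0 < lam) :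
    IntervalIntegrable (fun r => exp (-(p / r)) / r * volterra ((T - r) * lam)) volume 0 T := by
  rw [intervalIntegrable_iff_integrableOn_Ioc_of_le hT.le]
  have hφ := (integrableOn_exp_neg_div_div hp T).mono_set Set.Ioc_subset_Icc_self
  have hmono : Monotone fun x => volterra (max x 0) := fun x y hxy =>
    volterra_monotoneOn (Set.mem_Ici.2 (le_max_right _ _)) (Set.mem_Ici.2 (le_max_right _ _))
      (max_le_max_right 0 hxy)
  have hmeas : Measurable fun r => volterra (max ((T - r) * lam) 0) :=
    hmono.measurable.comp (by fun_prop)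
  refine hφ.mul_bdd (c := volterra (T * lam)) (hmeas.aestronglyMeasurable.congr ?_) ?_
  · filter_upwards [ae_restrict_mem measurableSet_Ioc] with r hr
    rw [max_eq_left (mul_nonneg (sub_nonneg.2 hr.2) hlam.le)]
  · filter_upwards [ae_restrict_mem measurableSet_Ioc] with r hr
    have h0 : 0 ≤ (T - r) * lam := mul_nonneg (sub_nonneg.2 hr.2) hlam.le
    rw [norm_of_nonneg (volterra_nonneg h0)]
    refine volterra_monotoneOn h0 (show 0 ≤ T * lam by positivity) ?_
    gcongr
    linarith [hr.1]

lemma intervalIntegrable_exp_neg_div_div {p T : ℝ} (hp : 0 < p) (hT : 0 < T) :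
    IntervalIntegrable (fun r => exp (-(p / r)) / r) volume 0 T :=
  (intervalIntegrable_iff_integrableOn_Icc_of_le hT.le).2 (integrableOn_exp_neg_div_div hp T)

lemma Hbar_eq (T lam a : ℝ) :
    Hbar T lam a =
      ∫ r in (0 : ℝ)..T, exp (-(a ^ 2 / 2 / r)) / r * volterra ((T - r) * lam) := by
  simp only [Hbar, div_div]

lemma Hbar_le_mul_integral {T lam a : ℝ} (hT : 0 < T) (hlam : 0 < lam) (ha : 0 < a) :
    Hbar T lam a ≤
      volterra (T * lam) * ∫ r in (0 : ℝ)..T, exp (-(a ^ 2 / 2 / r)) / r := by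
  have hp : 0 < a ^ 2 / 2 := by positivity
  rw [Hbar_eq, ← intervalIntegral.integral_const_mul]
  refine intervalIntegral.integral_mono_on_of_le_Ioo hT.le
    (intervalIntegrable_Hbar_integrand hp hT hlam)
    ((intervalIntegrable_exp_neg_div_div hp hT).const_mul _) fun r hr => ?_
  have hr0 := hr.1
  have h0 : 0 ≤ (T - r) * lam := mul_nonneg (sub_nonneg.2 hr.2.le) hlam.le
  rw [mul_comm]
  refine mul_le_mul_of_nonneg_right ?_ (by positivity)
  refine volterra_monotoneOn h0 (show 0 ≤ T * lam by positivity) ?_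
  gcongr
  linarith

lemma mul_integral_le_Hbar {T lam a : ℝ} (hT : 0 < T) (hlam : 0 < lam) (ha : 0 < a) :
    volterra (T * lam / 2) * ∫ r in (0 : ℝ)..T / 2, exp (-(a ^ 2 / 2 / r)) / r ≤
      Hbar T lam a := by
  have hp : 0 < a ^ 2 / 2 := by positivity
  have hint := intervalIntegrable_Hbar_integrand hp hT hlam
  rw [Hbar_eq, ← intervalIntegral.integral_const_mul]
  refine le_trans (intervalIntegral.integral_mono_on_of_le_Ioo (half_pos hT).le
    ((intervalIntegrable_exp_neg_div_div hp (half_pos hT)).const_mul _)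
    (hint.mono_set ?_) fun r hr => ?_)
    (intervalIntegral.integral_mono_interval le_rfl (half_pos hT).le (half_le_self hT.le) ?_ hint)
  · rw [Set.uIcc_of_le (half_pos hT).le, Set.uIcc_of_le hT.le]
    exact Set.Icc_subset_Icc_right (half_le_self hT.le)
  · have hr0 := hr.1
    have h0 : T * lam / 2 ≤ (T - r) * lam := by nlinarith [hr.2]
    have h1 : 0 ≤ T * lam / 2 := by positivity
    rw [mul_comm]
    exact mul_le_mul_of_nonneg_left (volterra_monotoneOn h1 (h1.trans h0) h0) (by positivity)
  · filter_upwards [ae_restrict_mem measurableSet_Ioc] with r hr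
    have hr0 := hr.1
    exact mul_nonneg (by positivity)
      (volterra_nonneg (mul_nonneg (sub_nonneg.2 hr.2) hlam.le))

/-- For every `L > 0` there are `c_L, C_L > 0` such that for all `a > 0` and `T, λ > 0` with
`Tλ ≤ L`:
`(c_L/(1+log⁺(1/(Tλ)))) (log⁺(2T/a²) + e^{−a²/T}/(1+a²/(2T))) ≤ H̄_T^λ(a)
  ≤ (C_L/(1+log⁺(1/(Tλ)))) (log⁺(2T/a²) + e^{−a²/(2T)}/(1+a²/(2T)))`. -/
theorem Hbar_upper_lower_bounds (L : ℝ) (hL : 0 < L) :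
    ∃ c > 0, ∃ C > 0, ∀ T lam a : ℝ, 0 < T → 0 < lam → 0 < a → T * lam ≤ L →
      (c / (1 + logPlus (1 / (T * lam)))) *
          (logPlus (2 * T / a ^ 2) + Real.exp (-(a ^ 2 / T)) / (1 + a ^ 2 / (2 * T)))
        ≤ Hbar T lam a ∧
      Hbar T lam a ≤
        (C / (1 + logPlus (1 / (T * lam)))) *
          (logPlus (2 * T / a ^ 2) + Real.exp (-(a ^ 2 / (2 * T))) / (1 + a ^ 2 / (2 * T))) := by
  refine ⟨exp (-1) * (exp (-2) / 8), by positivity,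
    exp (exp 1 * max L 1 + 1) * 8, by positivity, fun T lam a hT hlam ha hTL => ?_⟩
  have hp : 0 < a ^ 2 / 2 := by positivity
  have hx : 0 < T * lam := by positivity
  have hl := logPlus_nonneg (1 / (T * lam))
  have hl2 := logPlus_nonneg (2 * T / a ^ 2)
  have e1 : T / (a ^ 2 / 2) = 2 * T / a ^ 2 := by field_simp
  have e2 : 2 * (a ^ 2 / 2) / T = a ^ 2 / T := by field_simp
  have e3 : a ^ 2 / 2 / T = a ^ 2 / (2 * T) := div_div _ _ _
  constructor
  · have h := le_integral_exp_neg_div_div_half hp hT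
    rw [e1, e2, e3] at h
    calc _ = exp (-1) / (1 + logPlus (1 / (T * lam))) * (exp (-2) / 8 *
          (logPlus (2 * T / a ^ 2) + exp (-(a ^ 2 / T)) / (1 + a ^ 2 / (2 * T)))) := by ring
      _ ≤ volterra (T * lam / 2) * ∫ r in (0 : ℝ)..T / 2, exp (-(a ^ 2 / 2 / r)) / r :=
        mul_le_mul (le_volterra_half hx) h (by positivity) (volterra_nonneg (by positivity))
      _ ≤ _ := mul_integral_le_Hbar hT hlam ha
  · have h := integral_exp_neg_div_div_le hp hT
    rw [e1, e3] at h
    calc _ ≤ volterra (T * lam) * ∫ r in (0 : ℝ)..T, exp (-(a ^ 2 / 2 / r)) / r :=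
        Hbar_le_mul_integral hT hlam ha
      _ ≤ exp (exp 1 * max L 1 + 1) / (1 + logPlus (1 / (T * lam))) * (8 *
          (logPlus (2 * T / a ^ 2) + exp (-(a ^ 2 / (2 * T))) / (1 + a ^ 2 / (2 * T)))) := by
        refine mul_le_mul (volterra_le (le_max_right _ _) hx (hTL.trans (le_max_left _ _))) h
          (intervalIntegral.integral_nonneg hT.le fun r hr => ?_) (by positivity)
        exact div_nonneg (exp_pos _).le hr.1
      _ = _ := by ring
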